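/- arXiv:2204.05866 — 2 statements merged into one kernel-verified Lean document; each statement's English description precedes it below -/
import Mathlib

section
/- For every positive integer ℓ and every positive integer d, the ℓ-th elementary symmetric polynomial in the variables x₁, …, x_d over ℚ satisfies the closed-form Newton identity: e_ℓ = (−1)^ℓ · Σ_m ∏_{s=1}^{ℓ} (−p_s)^{m_s} / (m_s! · s^{m_s}), where the sum runs over all ℓ-tuples of non-negative integers m = (m₁, …, m_ℓ) with m₁ + 2m₂ + ⋯ + ℓ·m_ℓ = ℓ, and p_s = x₁^s + ⋯ + x_d^s is the s-th power sum. -/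
open MvPolynomial Finset

/-- The tuples `m : Fin L → ℕ` of multiplicities, bounded by `L`, of the parts of a partition
of `n` into parts of size at most `L`. -/
def partMultiplicities (L n : ℕ) : Finset (Fin L → ℕ) :=
  (Fintype.piFinset fun _ : Fin L => Finset.range (L + 1)).filter
    (fun m => ∑ s : Fin L, ((s : ℕ) + 1) * m s = n)

theorem succ_mul_le_sum_weight {L : ℕ} (m : Fin L → ℕ) (s : Fin L) :
    ((s : ℕ) + 1) * m s ≤ ∑ i : Fin L, ((i : ℕ) + 1) * m i :=
  Finset.single_le_sum (f := fun s : Fin L => ((s : ℕ) + 1) * m s)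
    (fun _ _ => Nat.zero_le _) (mem_univ s)

theorem mem_partMultiplicities {L n : ℕ} (hn : n ≤ L) (m : Fin L → ℕ) :
    m ∈ partMultiplicities L n ↔ ∑ s : Fin L, ((s : ℕ) + 1) * m s = n := by
  simp only [partMultiplicities, mem_filter, Fintype.mem_piFinset, Finset.mem_range,
    and_iff_right_iff_imp]
  intro h s
  have h1 := succ_mul_le_sum_weight m s
  have h2 := Nat.le_mul_of_pos_left (m s) (Nat.succ_pos (s : ℕ))
  simp only [Nat.succ_eq_add_one] at h2
  lia

section ExpCoeff

variable {R : Type*} [CommRing R] [Algebra ℚ R]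

/-- The summand `∏ₛ aₛ ^ mₛ / (mₛ! * s ^ mₛ)`, where entry `s` of `m` belongs to the part `s + 1`. -/
def partTerm (a : ℕ → R) {L : ℕ} (m : Fin L → ℕ) : R :=
  ∏ s : Fin L, algebraMap ℚ R ((1 : ℚ) / ((m s).factorial * ((s : ℕ) + 1) ^ m s)) *
    a ((s : ℕ) + 1) ^ m s

/-- The coefficient of degree `n` of `exp (∑ₛ aₛ Xˢ / s)`, for `n ≤ L`. -/
def expCoeff (a : ℕ → R) (L n : ℕ) : R :=
  ∑ m ∈ partMultiplicities L n, partTerm a m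

theorem partTerm_add_single (a : ℕ → R) {L : ℕ} (m : Fin L → ℕ) (s : Fin L) :
    (((s : ℕ) + 1) * (m s + 1) : R) * partTerm a (m + Pi.single s 1) =
      a ((s : ℕ) + 1) * partTerm a m := by
  unfold partTerm
  rw [← Finset.mul_prod_erase univ _ (mem_univ s),
    ← Finset.mul_prod_erase univ (fun i : Fin L => algebraMap ℚ R _ * _) (mem_univ s)]
  have hrest : ∀ i ∈ univ.erase s, (m + Pi.single s 1 : Fin L → ℕ) i = m i := fun i hi => by
    simp [ne_of_mem_erase hi]
  rw [Finset.prod_congr rfl fun i hi => by rw [hrest i hi]]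
  have hcoeff : (((s : ℕ) + 1) * (m s + 1) : R) *
      algebraMap ℚ R (1 / ((m s + 1).factorial * ((s : ℕ) + 1) ^ (m s + 1))) =
        algebraMap ℚ R (1 / ((m s).factorial * ((s : ℕ) + 1) ^ m s)) := by
    have hcast : (((s : ℕ) + 1) * (m s + 1) : R) =
        algebraMap ℚ R (((s : ℕ) + 1) * (m s + 1)) := by simp
    rw [hcast, ← map_mul]
    congr 1
    have := Nat.factorial_ne_zero (m s)
    rw [Nat.factorial_succ]
    push_cast
    field_simp
    ring
  simp only [Pi.add_apply, Pi.single_eq_same]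
  rw [← hcoeff]
  ring

theorem sum_weight_add_single {L : ℕ} (m : Fin L → ℕ) (s : Fin L) :
    ∑ i : Fin L, ((i : ℕ) + 1) * (m + Pi.single s 1 : Fin L → ℕ) i =
      (∑ i : Fin L, ((i : ℕ) + 1) * m i) + (s + 1) := by
  simp [mul_add, Finset.sum_add_distrib, Pi.single_apply]

theorem sum_mul_partTerm (a : ℕ → R) {L n : ℕ} (hn : n ≤ L) (s : Fin L) :
    ∑ m ∈ partMultiplicities L n, (((s : ℕ) + 1) * m s : R) * partTerm a m =
      if (s : ℕ) < n then a (s + 1) * expCoeff a L (n - (s + 1)) else 0 := by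
  have hle : ∀ m ∈ partMultiplicities L n, m s ≠ 0 → (s : ℕ) < n := fun m hm h0 => by
    rw [mem_partMultiplicities hn] at hm
    have h1 := succ_mul_le_sum_weight m s
    have h2 := Nat.le_mul_of_pos_right ((s : ℕ) + 1) (Nat.pos_of_ne_zero h0)
    lia
  split_ifs with hs
  · rw [expCoeff, Finset.mul_sum]
    symm
    refine Finset.sum_of_injOn (fun m => m + Pi.single s 1)
      (fun _ _ _ _ h => add_right_cancel h) ?_ ?_ ?_
    · intro m hm
      rw [mem_coe, mem_partMultiplicities (by lia)] at hm
      rw [mem_coe, mem_partMultiplicities hn, sum_weight_add_single, hm]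
      lia
    · intro m hm hnot
      by_cases h0 : m s = 0
      · simp [h0]
      have hm' : m - Pi.single s 1 + Pi.single s 1 = m := by
        ext i
        by_cases hi : i = s
        · subst hi
          simp
          lia
        · simp [hi]
      refine absurd ⟨m - Pi.single s 1, ?_, hm'⟩ hnot
      rw [mem_partMultiplicities hn, ← hm', sum_weight_add_single] at hm
      rw [mem_coe, mem_partMultiplicities (by lia)]
      lia
    · intro m _
      simpa using (partTerm_add_single a m s).symm
  · refine Finset.sum_eq_zero fun m hm => ?_
    have h0 : m s = 0 := by_contra fun h => hs (hle m hm h)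
    simp [h0]

theorem nat_mul_expCoeff (a : ℕ → R) {L n : ℕ} (hn : n ≤ L) :
    (n : R) * expCoeff a L n =
      ∑ p ∈ antidiagonal n with p.1 < n, expCoeff a L p.1 * a p.2 := by
  have hweight : (n : R) * expCoeff a L n = ∑ s : Fin L,
      ∑ m ∈ partMultiplicities L n, (((s : ℕ) + 1) * m s : R) * partTerm a m := by
    rw [Finset.sum_comm, expCoeff, Finset.mul_sum]
    refine Finset.sum_congr rfl fun m hm => ?_
    rw [mem_partMultiplicities hn] at hm
    rw [← Finset.sum_mul, ← hm]
    push_cast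
    rfl
  rw [hweight, Finset.sum_congr rfl fun s _ => sum_mul_partTerm a hn s,
    Fin.sum_univ_eq_sum_range
      (fun s => if s < n then a (s + 1) * expCoeff a L (n - (s + 1)) else 0) L,
    ← Finset.sum_filter]
  refine Finset.sum_bij' (fun s _ => (n - (s + 1), s + 1)) (fun p _ => p.2 - 1) ?_ ?_ ?_ ?_ ?_
  · intro s hs
    simp only [mem_filter, Finset.mem_range, HasAntidiagonal.mem_antidiagonal] at hs ⊢
    lia
  · intro p hp
    simp only [mem_filter, Finset.mem_range, HasAntidiagonal.mem_antidiagonal] at hp ⊢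
    lia
  · intro s _
    simp
  · rintro ⟨i, j⟩ hp
    simp only [mem_filter, HasAntidiagonal.mem_antidiagonal] at hp
    ext <;> simp only <;> lia
  · intro s _
    exact mul_comm _ _

theorem expCoeff_zero (a : ℕ → R) (L : ℕ) : expCoeff a L 0 = 1 := by
  have hzero : partMultiplicities L 0 = {0} := by
    ext m
    simp [mem_partMultiplicities (Nat.zero_le L), funext_iff]
  simp [expCoeff, hzero, partTerm]

end ExpCoeff

theorem expCoeff_neg_psum (σ : Type*) [Fintype σ] {L n : ℕ} (hn : n ≤ L) :
    expCoeff (fun s => -psum σ ℚ s) L n = (-1) ^ n * esymm σ ℚ n := by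
  induction n using Nat.strong_induction_on with
  | _ n ih =>
    rcases Nat.eq_zero_or_pos n with rfl | hpos
    · simp [expCoeff_zero]
    have hn0 : (n : MvPolynomial σ ℚ) ≠ 0 := Nat.cast_ne_zero.mpr hpos.ne'
    refine mul_left_cancel₀ hn0 ?_
    have hsign : (-1 : MvPolynomial σ ℚ) ^ n * (-1) ^ (n + 1) = -1 := by
      rw [← pow_add, Odd.neg_one_pow ⟨n, by ring⟩]
    rw [nat_mul_expCoeff _ hn, mul_left_comm, mul_esymm_eq_sum, ← mul_assoc, hsign,
      neg_one_mul, ← Finset.sum_neg_distrib]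
    refine Finset.sum_congr rfl fun p hp => ?_
    have hlt := (mem_filter.mp hp).2
    rw [ih p.1 hlt (hlt.le.trans hn), mul_neg]

/-- Newton's identity in closed form: for `ℓ, d > 0`, the `ℓ`-th elementary symmetric
polynomial in `d` variables over `ℚ` equals
`(−1)^ℓ · Σ_m ∏_{s=1}^{ℓ} (−p_s)^{m_s} / (m_s! · s^{m_s})`,
the sum running over tuples `m = (m₁, …, m_ℓ)` of non-negative integers with
`m₁ + 2m₂ + ⋯ + ℓ·m_ℓ = ℓ`, where `p_s` is the `s`-th power sum. -/
theorem esymm_eq_sum_powerSums (ℓ d : ℕ) (hℓ : 0 < ℓ) (hd : 0 < d) :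
    esymm (Fin d) ℚ ℓ =
      (-1 : MvPolynomial (Fin d) ℚ) ^ ℓ *
        ∑ m ∈ (Fintype.piFinset fun _ : Fin ℓ => Finset.range (ℓ + 1)).filter
            (fun m => ∑ s : Fin ℓ, ((s : ℕ) + 1) * m s = ℓ),
          ∏ s : Fin ℓ,
            C ((1 : ℚ) / ((m s).factorial * ((s : ℕ) + 1) ^ m s)) *
              (-psum (Fin d) ℚ ((s : ℕ) + 1)) ^ m s := by
  have h := expCoeff_neg_psum (Fin d) (le_refl ℓ)
  change _ = (-1) ^ ℓ * expCoeff (fun s => -psum (Fin d) ℚ s) ℓ ℓ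
  rw [h, ← mul_assoc, ← mul_pow, neg_one_mul, neg_neg, one_pow, one_mul]
end

section
/- Let d, χ be integers with d ≥ 4, 0 < χ < d, and gcd(d, χ) = 1. Then the 3×3 matrix M over ℚ with rows: first row (χ − 3d/2, χ − d/2, χ + d/2); second row ((−2χ² + 6χd − 5d² + d)/(4(1−d)), (−2χ² + 6χd − 4χ − 3d² + 3d)/(4(1−d)), (−2χ² + 6χd − 8χ + 3d² − 3d)/(4(1−d))); third row (0, (χ² − 2χd + χ + d² − d)/(2(1−d)), (2χ² − 2χd + 4χ − d² + d)/(2(1−d))) has nonzero determinant, i.e., M is invertible. -/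
/-- The determinant of the coefficient matrix in closed form. -/
theorem coefficient_matrix_det {K : Type*} [Field K] [CharZero K] (d χ : K) (hd : 1 - d ≠ 0) :
    (Matrix.of
        ![![χ - 3 * d / 2, χ - d / 2, χ + d / 2],
          ![(-2 * χ ^ 2 + 6 * χ * d - 5 * d ^ 2 + d) / (4 * (1 - d)),
            (-2 * χ ^ 2 + 6 * χ * d - 4 * χ - 3 * d ^ 2 + 3 * d) / (4 * (1 - d)),
            (-2 * χ ^ 2 + 6 * χ * d - 8 * χ + 3 * d ^ 2 - 3 * d) / (4 * (1 - d))],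
          ![0, (χ ^ 2 - 2 * χ * d + χ + d ^ 2 - d) / (2 * (1 - d)),
            (2 * χ ^ 2 - 2 * χ * d + 4 * χ - d ^ 2 + d) / (2 * (1 - d))]]).det =
      χ * (d - 2) * (d - χ) * (d - 2 * χ) / (4 * (1 - d) ^ 2) := by
  simp only [Matrix.det_fin_three, Matrix.of_apply, Matrix.cons_val]
  field_simp
  ring

/-- For integers `d ≥ 4`, `0 < χ < d`, `gcd(d,χ) = 1`, the 3×3 matrix of coefficients of
`e_d(0), e_{d−1}(1), e_{d−2}(2)` in the relations `R₁, R₂, R₃` has nonzero determinant,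
i.e. it is invertible. -/
theorem coefficient_matrix_invertible (d χ : ℤ) (hd : 4 ≤ d) (hχ₀ : 0 < χ) (hχd : χ < d)
    (hcop : Int.gcd d χ = 1) :
    (Matrix.of
        ![![(χ : ℚ) - 3 * d / 2, χ - d / 2, χ + d / 2],
          ![(-2 * (χ : ℚ) ^ 2 + 6 * χ * d - 5 * d ^ 2 + d) / (4 * (1 - d)),
            (-2 * χ ^ 2 + 6 * χ * d - 4 * χ - 3 * d ^ 2 + 3 * d) / (4 * (1 - d)),
            (-2 * χ ^ 2 + 6 * χ * d - 8 * χ + 3 * d ^ 2 - 3 * d) / (4 * (1 - d))],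
          ![0, ((χ : ℚ) ^ 2 - 2 * χ * d + χ + d ^ 2 - d) / (2 * (1 - d)),
            (2 * χ ^ 2 - 2 * χ * d + 4 * χ - d ^ 2 + d) / (2 * (1 - d))]]).det ≠ 0 := by
  have h1 : (1 - d : ℚ) ≠ 0 := by exact_mod_cast (by omega : 1 - d ≠ 0)
  have h2 : (d - 2 : ℚ) ≠ 0 := by exact_mod_cast (by omega : d - 2 ≠ 0)
  have h3 : (d - χ : ℚ) ≠ 0 := by exact_mod_cast (by omega : d - χ ≠ 0)
  have h4 : (χ : ℚ) ≠ 0 := by exact_mod_cast hχ₀.ne'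
  have h5 : d - 2 * χ ≠ 0 := by
    intro h
    have hdvd : χ ∣ d := ⟨2, by omega⟩
    have hunit : χ ∣ 1 := by
      simpa [hcop] using Int.dvd_coe_gcd hdvd (dvd_refl χ)
    have := Int.le_of_dvd one_pos hunit
    omega
  have h6 : (d - 2 * χ : ℚ) ≠ 0 := by exact_mod_cast h5
  rw [coefficient_matrix_det _ _ h1]
  positivity
end
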